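/- arXiv:1306.1409 — 2 statements merged into one kernel-verified Lean document; each statement's English description precedes it below -/
import Mathlib

section
/- Let (a_n) be a sequence of positive integers with a_n/n → 0 as n → ∞. Then lim_{n→∞} ∫_1^∞ (θ_{Λ_n}(n²t) − 1) dt/t = ∫_1^∞ (Θ_B(t) − 1) dt/t. -/
open Real MeasureTheory Filter Finset

/-- Eigenvalues of the combinatorial Laplacian on the discrete torus
`ℤ^d/Λ_n ℤ^d`, `Λ_n = diag(α_1 a_n, …, α_p a_n, β_1 n, …, β_{d-p} n)`. -/
noncomputable def torusLam (d p : ℕ) (α : Fin p → ℕ) (β : Fin (d - p) → ℕ) (a n : ℕ)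
    (x : ((i : Fin p) → Fin (α i * a)) × ((i : Fin (d - p)) → Fin (β i * n))) : ℝ :=
  2 * d - 2 * ∑ i, Real.cos (2 * π * (x.1 i : ℕ) / (α i * a))
        - 2 * ∑ i, Real.cos (2 * π * (x.2 i : ℕ) / (β i * n))

/-- Theta function of the discrete torus `ℤ^d/Λ_n ℤ^d`. -/
noncomputable def torusTheta (d p : ℕ) (α : Fin p → ℕ) (β : Fin (d - p) → ℕ)
    (a n : ℕ) (t : ℝ) : ℝ :=
  ∑ x : ((i : Fin p) → Fin (α i * a)) × ((i : Fin (d - p)) → Fin (β i * n)),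
    Real.exp (-(torusLam d p α β a n x) * t)

/-- Theta function of the real torus `ℝ^{d-p}/Bℤ^{d-p}`, `B = diag(β_1, …, β_{d-p})`. -/
noncomputable def ThetaB (d p : ℕ) (β : Fin (d - p) → ℕ) (t : ℝ) : ℝ :=
  ∑' k : Fin (d - p) → ℤ, Real.exp (-4 * π ^ 2 * t * ∑ i, (k i : ℝ) ^ 2 / (β i : ℝ) ^ 2)

/-- Theta function of the cycle `ℤ/Mℤ`. -/
noncomputable def cycleTheta (M : ℕ) (s : ℝ) : ℝ :=
  ∑ m : Fin M, Real.exp (-(2 - 2 * Real.cos (2 * π * (m : ℕ) / M)) * s)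

/-- The summands of `cycleTheta`, indexed by the representatives of `ℤ/Mℤ` in `(-M/2, M/2]`. -/
noncomputable def cycleTerm (M : ℕ) (s : ℝ) (k : ℤ) : ℝ :=
  if -(M : ℤ) < 2 * k ∧ 2 * k ≤ M then
    Real.exp (-(2 - 2 * Real.cos (2 * π * k / M)) * s) else 0

theorem cycleTheta_eq_tsum {M : ℕ} (hM : 0 < M) (s : ℝ) :
    cycleTheta M s = ∑' k : ℤ, cycleTerm M s k := by
  have hM' : (M : ℝ) ≠ 0 := by positivity
  let g : Fin M → ℤ := fun m => if 2 * (m : ℕ) ≤ M then (m : ℕ) else (m : ℕ) - (M : ℤ)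
  have hg : Function.Injective g := by
    intro x y hxy
    have hx := x.isLt
    have hy := y.isLt
    simp only [g] at hxy
    apply Fin.ext
    split_ifs at hxy <;> omega
  have hsupp : Function.support (cycleTerm M s) ⊆ Set.range g := by
    intro k hk
    have hk' : -(M : ℤ) < 2 * k ∧ 2 * k ≤ M := by
      by_contra h
      exact hk (if_neg h)
    by_cases h0 : 0 ≤ k
    · refine ⟨⟨k.toNat, by omega⟩, ?_⟩
      simp only [g]
      split_ifs <;> omega
    · refine ⟨⟨(k + M).toNat, by omega⟩, ?_⟩
      simp only [g]
      split_ifs <;> omega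
  rw [← hg.tsum_eq hsupp, tsum_fintype, cycleTheta]
  refine Finset.sum_congr rfl fun m _ => ?_
  have hm := m.isLt
  by_cases h : 2 * (m : ℕ) ≤ M
  · have hgm : g m = (m : ℕ) := if_pos h
    rw [hgm, cycleTerm, if_pos (by omega)]
    simp
  · have hgm : g m = (m : ℕ) - (M : ℤ) := if_neg h
    rw [hgm, cycleTerm, if_pos (by omega)]
    have : 2 * π * (((m : ℕ) - (M : ℤ) : ℤ) : ℝ) / M = 2 * π * (m : ℕ) / M - 2 * π := by
      push_cast
      field_simp
    rw [this, Real.cos_sub_two_pi]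

theorem two_sub_two_mul_cos_two_mul (x : ℝ) :
    2 - 2 * Real.cos (2 * x) = 4 * Real.sin x ^ 2 := by
  rw [Real.cos_two_mul]
  linarith [Real.sin_sq_add_cos_sq x]

theorem sq_div_sq_le_two_sub_two_mul_cos {M : ℕ} (hM : 0 < M) {k : ℤ} (hk : |2 * k| ≤ M) :
    16 * (k : ℝ) ^ 2 / (M : ℝ) ^ 2 ≤ 2 - 2 * Real.cos (2 * π * k / M) := by
  have hM' : (0 : ℝ) < M := by positivity
  have hkR : 2 * |(k : ℝ)| ≤ M := by
    have : ((|2 * k| : ℤ) : ℝ) ≤ M := by exact_mod_cast hk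
    simpa [abs_mul] using this
  have habs : |π * k / M| = π * |(k : ℝ)| / M := by
    rw [abs_div, abs_mul, abs_of_pos Real.pi_pos, abs_of_pos hM']
  have h1 := Real.mul_abs_le_abs_sin (x := π * k / M) (by
    rw [habs, div_le_div_iff₀ hM' two_pos]
    nlinarith [Real.pi_pos])
  rw [habs] at h1
  have h2 : 2 / π * (π * |(k : ℝ)| / M) = 2 * |(k : ℝ)| / M := by field_simp
  rw [h2] at h1
  have h3 := pow_le_pow_left₀ (by positivity) h1 2
  rw [sq_abs, div_pow, mul_pow, sq_abs] at h3
  rw [show 2 * π * (k : ℝ) / M = 2 * (π * k / M) by ring, two_sub_two_mul_cos_two_mul]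
  calc 16 * (k : ℝ) ^ 2 / (M : ℝ) ^ 2 = 4 * (2 ^ 2 * (k : ℝ) ^ 2 / (M : ℝ) ^ 2) := by ring
    _ ≤ _ := by linarith

theorem cycleTerm_nonneg (M : ℕ) (s : ℝ) (k : ℤ) : 0 ≤ cycleTerm M s k := by
  rw [cycleTerm]
  split_ifs <;> positivity

theorem cycleTerm_le {M : ℕ} (hM : 0 < M) {s : ℝ} (hs : 0 ≤ s) (k : ℤ) :
    cycleTerm M s k ≤ Real.exp (-(16 * (s / (M : ℝ) ^ 2)) * (k : ℝ) ^ 2) := by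
  rw [cycleTerm]
  split_ifs with h
  · have h1 := mul_le_mul_of_nonneg_right
      (sq_div_sq_le_two_sub_two_mul_cos hM (k := k) (by rw [abs_le]; omega)) hs
    apply Real.exp_le_exp.2
    have h2 : -(16 * (s / (M : ℝ) ^ 2)) * (k : ℝ) ^ 2 = -(16 * (k : ℝ) ^ 2 / (M : ℝ) ^ 2 * s) := by
      ring
    rw [h2]
    linarith
  · positivity

theorem summable_exp_neg_mul_int_sq {c : ℝ} (hc : 0 < c) :
    Summable fun k : ℤ => Real.exp (-c * (k : ℝ) ^ 2) := by
  refine (summable_pow_mul_jacobiTheta₂_term_bound 0 (div_pos hc Real.pi_pos) 0).congr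
    fun k => ?_
  rw [pow_zero, one_mul]
  congr 1
  field_simp
  ring

theorem one_le_cycleTheta {M : ℕ} (hM : 0 < M) (s : ℝ) : 1 ≤ cycleTheta M s := by
  have : NeZero M := ⟨hM.ne'⟩
  have h := Finset.single_le_sum
    (f := fun m : Fin M => Real.exp (-(2 - 2 * Real.cos (2 * π * (m : ℕ) / M)) * s))
    (fun m _ => (Real.exp_pos _).le) (Finset.mem_univ (0 : Fin M))
  simpa [cycleTheta] using h

theorem cycleTheta_le {M : ℕ} (hM : 0 < M) {s δ : ℝ} (hδ : 0 < δ) (hs : δ ≤ s / (M : ℝ) ^ 2) :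
    cycleTheta M s ≤ 1 + (∑' k : ℤ, Real.exp (-(8 * δ) * (k : ℝ) ^ 2)) *
      Real.exp (-(8 * (s / (M : ℝ) ^ 2))) := by
  have hM' : (0 : ℝ) < M := by positivity
  have hs0 : 0 ≤ s := by
    by_contra h
    have := div_neg_of_neg_of_pos (not_le.1 h) (pow_pos hM' 2)
    linarith
  set c := s / (M : ℝ) ^ 2
  have hsum : Summable fun k : ℤ =>
      (if k = 0 then (1 : ℝ) else 0) + Real.exp (-(8 * δ) * (k : ℝ) ^ 2) * Real.exp (-(8 * c)) :=
    (hasSum_ite_eq (0 : ℤ) (1 : ℝ)).summable.add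
      ((summable_exp_neg_mul_int_sq (by positivity)).mul_right _)
  have hle (k : ℤ) : cycleTerm M s k ≤
      (if k = 0 then (1 : ℝ) else 0) + Real.exp (-(8 * δ) * (k : ℝ) ^ 2) * Real.exp (-(8 * c)) := by
    refine (cycleTerm_le hM hs0 k).trans ?_
    split_ifs with hk
    · subst hk
      simpa using (Real.exp_pos _).le
    · rw [zero_add, ← Real.exp_add]
      apply Real.exp_le_exp.2
      have hk1 : (1 : ℝ) ≤ (k : ℝ) ^ 2 := by
        have : 1 ≤ k ^ 2 := Int.one_le_abs (pow_ne_zero 2 hk) |>.trans_eq (abs_of_nonneg (sq_nonneg k))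
        exact_mod_cast this
      nlinarith [mul_le_mul_of_nonneg_right hs (sq_nonneg (k : ℝ)),
        mul_le_mul_of_nonneg_left hk1 (hδ.le.trans hs)]
  rw [cycleTheta_eq_tsum hM]
  refine (Summable.tsum_le_tsum hle (hsum.of_nonneg_of_le (cycleTerm_nonneg M s) hle) hsum).trans_eq ?_
  rw [Summable.tsum_add (hasSum_ite_eq (0 : ℤ) (1 : ℝ)).summable
    ((summable_exp_neg_mul_int_sq (by positivity)).mul_right _), tsum_ite_eq, tsum_mul_right]

theorem tendsto_natCast_mul_sin_div (c : ℝ) :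
    Tendsto (fun n : ℕ => (n : ℝ) * Real.sin (c / n)) atTop (nhds c) := by
  have h : Tendsto (fun n : ℕ => c * Real.sinc (c / n)) atTop (nhds (c * Real.sinc 0)) :=
    ((Real.continuous_sinc.tendsto 0).comp
      (tendsto_const_div_atTop_nhds_zero_nat c)).const_mul c
  rw [Real.sinc_zero, mul_one] at h
  refine h.congr' ?_
  filter_upwards [eventually_gt_atTop 0] with n hn
  have hn' : (n : ℝ) ≠ 0 := by positivity
  rcases eq_or_ne c 0 with rfl | hc
  · simp
  · rw [Real.sinc_of_ne_zero (by positivity)]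
    field_simp

theorem tendsto_cycleTheta_linear {b : ℕ} (hb : 0 < b) {t : ℝ} (ht : 0 < t) :
    Tendsto (fun n : ℕ => cycleTheta (b * n) ((n : ℝ) ^ 2 * t)) atTop
      (nhds (∑' k : ℤ, Real.exp (-4 * π ^ 2 * t * ((k : ℝ) ^ 2 / (b : ℝ) ^ 2)))) := by
  have hb' : (0 : ℝ) < b := by positivity
  have key : Tendsto (fun n : ℕ => ∑' k : ℤ, cycleTerm (b * n) ((n : ℝ) ^ 2 * t) k) atTop
      (nhds (∑' k : ℤ, Real.exp (-4 * π ^ 2 * t * ((k : ℝ) ^ 2 / (b : ℝ) ^ 2)))) := by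
    refine tendsto_tsum_of_dominated_convergence
      (bound := fun k : ℤ => Real.exp (-(16 * (t / (b : ℝ) ^ 2)) * (k : ℝ) ^ 2))
      (summable_exp_neg_mul_int_sq (by positivity)) (fun k => ?_) ?_
    · have h := ((((tendsto_natCast_mul_sin_div (π * k / b)).pow 2).mul_const (-4 * t)).rexp)
      have e : (π * (k : ℝ) / b) ^ 2 * (-4 * t) = -4 * π ^ 2 * t * ((k : ℝ) ^ 2 / (b : ℝ) ^ 2) := by
        ring
      rw [e] at h
      refine h.congr' ?_
      filter_upwards [eventually_gt_atTop (2 * k.natAbs)] with n hn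
      have hbn : n ≤ b * n := Nat.le_mul_of_pos_left n hb
      have hbn' : 2 * k.natAbs < b * n := hn.trans_le hbn
      rw [cycleTerm, if_pos (by omega), Nat.cast_mul,
        show 2 * π * (k : ℝ) / (b * n) = 2 * (π * k / b / n) by
          rw [div_div, ← mul_div_assoc, mul_assoc],
        two_sub_two_mul_cos_two_mul]
      congr 1
      ring
    · filter_upwards [eventually_gt_atTop 0] with n hn k
      have hn' : (n : ℝ) ≠ 0 := by positivity
      rw [Real.norm_of_nonneg (cycleTerm_nonneg _ _ _)]
      refine (cycleTerm_le (by positivity) (by positivity) k).trans_eq ?_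
      congr 3
      push_cast
      field_simp
  refine key.congr' ?_
  filter_upwards [eventually_gt_atTop 0] with n hn
  rw [cycleTheta_eq_tsum (by positivity)]

theorem tendsto_cycleTheta_sublinear {M : ℕ → ℕ} (hM : ∀ n, 0 < M n)
    (hsub : Tendsto (fun n : ℕ => (M n : ℝ) / n) atTop (nhds 0)) {t : ℝ} (ht : 0 < t) :
    Tendsto (fun n : ℕ => cycleTheta (M n) ((n : ℝ) ^ 2 * t)) atTop (nhds 1) := by
  have hpos : ∀ᶠ n : ℕ in atTop, 0 < (M n : ℝ) / n := by
    filter_upwards [eventually_gt_atTop 0] with n hn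
    have := hM n
    positivity
  have hinv : Tendsto (fun n : ℕ => ((M n : ℝ) / n)⁻¹) atTop atTop :=
    (tendsto_nhdsWithin_iff.2 ⟨hsub, hpos⟩).inv_tendsto_nhdsGT_zero
  have hlim : Tendsto (fun n : ℕ => (n : ℝ) ^ 2 * t / (M n : ℝ) ^ 2) atTop atTop := by
    have := ((tendsto_pow_atTop two_ne_zero).comp hinv).atTop_mul_const ht
    refine this.congr fun n => ?_
    simp only [Function.comp_apply, inv_div, div_pow]
    ring
  have hexp : Tendsto (fun n : ℕ => 1 + (∑' k : ℤ, Real.exp (-(8 * 1) * (k : ℝ) ^ 2)) *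
      Real.exp (-(8 * ((n : ℝ) ^ 2 * t / (M n : ℝ) ^ 2)))) atTop (nhds 1) := by
    have := ((Real.tendsto_exp_neg_atTop_nhds_zero.comp
      (hlim.const_mul_atTop (by norm_num : (0 : ℝ) < 8))).const_mul
        (∑' k : ℤ, Real.exp (-(8 * 1) * (k : ℝ) ^ 2))).const_add 1
    simpa using this
  refine tendsto_of_tendsto_of_tendsto_of_le_of_le' tendsto_const_nhds hexp
    (Eventually.of_forall fun n => one_le_cycleTheta (hM n) _) ?_
  filter_upwards [hlim.eventually_ge_atTop 1] with n hn
  exact cycleTheta_le (hM n) one_pos hn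

theorem torusTheta_eq_prod {d p : ℕ} (hpd : p ≤ d) (α : Fin p → ℕ) (β : Fin (d - p) → ℕ)
    (a n : ℕ) (t : ℝ) :
    torusTheta d p α β a n t =
      (∏ i, cycleTheta (α i * a) t) * ∏ i, cycleTheta (β i * n) t := by
  simp only [cycleTheta]
  rw [Fintype.prod_sum, Fintype.prod_sum, Fintype.sum_mul_sum, ← Fintype.sum_prod_type', torusTheta]
  refine Finset.sum_congr rfl fun x _ => ?_
  rw [← Real.exp_sum, ← Real.exp_sum, ← Real.exp_add, ← Finset.sum_mul, ← Finset.sum_mul,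
    ← add_mul, torusLam]
  congr 2
  simp only [Finset.sum_neg_distrib, Finset.sum_sub_distrib, ← Finset.mul_sum, Finset.sum_const,
    Finset.card_univ, Fintype.card_fin, nsmul_eq_mul, Nat.cast_sub hpd, Nat.cast_mul]
  ring

theorem hasSum_pi_prod_of_nonneg {κ : Type*} {m : ℕ} {f : Fin m → κ → ℝ}
    (hf : ∀ i, Summable (f i)) (hf0 : ∀ i k, 0 ≤ f i k) :
    HasSum (fun k : Fin m → κ => ∏ i, f i (k i)) (∏ i, ∑' k, f i k) := by
  induction m with
  | zero => simp
  | succ m ih =>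
    have htail := ih (fun i => hf i.succ) fun i => hf0 i.succ
    have hcons : (fun k : Fin (m + 1) → κ => ∏ i, f i (k i)) ∘ Fin.consEquiv (fun _ => κ) =
        fun x => f 0 x.1 * ∏ i, f (Fin.succ i) (x.2 i) := by
      funext x
      simp [Fin.prod_univ_succ, Fin.consEquiv]
    have hsummable : Summable fun x : κ × (Fin m → κ) =>
        f 0 x.1 * ∏ i, f (Fin.succ i) (x.2 i) :=
      (hf 0).mul_of_nonneg (g := fun k : Fin m → κ => ∏ i, f (Fin.succ i) (k i)) htail.summable
        (hf0 0) fun k => Finset.prod_nonneg fun i _ => hf0 i.succ (k i)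
    rw [← (Fin.consEquiv fun _ : Fin (m + 1) => κ).hasSum_iff, hcons,
      Fin.prod_univ_succ]
    exact HasSum.mul (f := f 0) (g := fun k : Fin m → κ => ∏ i, f (Fin.succ i) (k i))
      (hf 0).hasSum htail hsummable

theorem ThetaB_eq_prod {d p : ℕ} {β : Fin (d - p) → ℕ} (hβ : ∀ i, 0 < β i) {t : ℝ} (ht : 0 < t) :
    ThetaB d p β t =
      ∏ i, ∑' k : ℤ, Real.exp (-4 * π ^ 2 * t * ((k : ℝ) ^ 2 / (β i : ℝ) ^ 2)) := by
  refine Eq.trans ?_ (hasSum_pi_prod_of_nonneg (fun i => ?_) fun i k => (Real.exp_pos _).le).tsum_eq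
  · refine tsum_congr fun k => ?_
    rw [← Real.exp_sum, ← Finset.mul_sum]
  · have hβi : (0 : ℝ) < β i := Nat.cast_pos.2 (hβ i)
    refine (summable_exp_neg_mul_int_sq (c := 4 * π ^ 2 * t / (β i : ℝ) ^ 2)
      (by positivity)).congr fun k => ?_
    congr 1
    ring

theorem one_add_pow_sub_one_le {y K : ℝ} (hy : 0 ≤ y) (hyK : y ≤ K) (N : ℕ) :
    (1 + y) ^ N - 1 ≤ N * (1 + K) ^ N * y := by
  have hK : 0 ≤ K := hy.trans hyK
  induction N with
  | zero => simp
  | succ N ih =>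
    have h1 : (1 + y) ^ N ≤ (1 + K) ^ N := by gcongr
    have h2 : (1 + K) ^ N ≤ (1 + K) ^ (N + 1) := pow_le_pow_right₀ (by linarith) (Nat.le_succ N)
    have h3 : N * (1 + K) ^ N * y ≤ N * (1 + K) ^ (N + 1) * y := by gcongr
    have h4 : (1 + y) ^ N * y ≤ (1 + K) ^ (N + 1) * y := by gcongr; exact h1.trans h2
    rw [pow_succ (1 + y)]
    push_cast
    linarith

theorem exists_torusTheta_sub_one_le {d p : ℕ} (hpd : p ≤ d) {α : Fin p → ℕ} (hα : ∀ i, 0 < α i)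
    {β : Fin (d - p) → ℕ} (hβ : ∀ i, 0 < β i) :
    ∃ C c : ℝ, 0 < c ∧ ∀ a n : ℕ, 0 < a → 0 < n → a ≤ n → ∀ t : ℝ, 1 ≤ t →
      0 ≤ torusTheta d p α β a n (n ^ 2 * t) - 1 ∧
        torusTheta d p α β a n (n ^ 2 * t) - 1 ≤ C * Real.exp (-c * t) := by
  obtain ⟨B, hB, hαB, hβB⟩ : ∃ B : ℕ, 0 < B ∧ (∀ i, α i ≤ B) ∧ ∀ i, β i ≤ B :=
    ⟨1 + ∑ i, α i + ∑ i, β i, by omega,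
      fun i => by
        have := Finset.single_le_sum (f := α) (fun _ _ => Nat.zero_le _) (Finset.mem_univ i)
        omega,
      fun i => by
        have := Finset.single_le_sum (f := β) (fun _ _ => Nat.zero_le _) (Finset.mem_univ i)
        omega⟩
  have hB' : (0 : ℝ) < B := by positivity
  set δ : ℝ := 1 / (B : ℝ) ^ 2 with hδ_def
  have hδ : 0 < δ := by positivity
  set K : ℝ := ∑' k : ℤ, Real.exp (-(8 * δ) * (k : ℝ) ^ 2)
  have hK : 0 ≤ K := tsum_nonneg fun k => (Real.exp_pos _).le
  refine ⟨d * (1 + K) ^ d * K, 8 * δ, by positivity, fun a n ha hn han t ht => ?_⟩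
  have hn' : (0 : ℝ) < n := by positivity
  set y : ℝ := K * Real.exp (-(8 * δ) * t) with hy_def
  have hy : 0 ≤ y := by positivity
  have hyK : y ≤ K := mul_le_of_le_one_right hK
    (Real.exp_le_one_iff.2 (by nlinarith))
  have hcycle : ∀ M : ℕ, 0 < M → M ≤ B * n → cycleTheta M ((n : ℝ) ^ 2 * t) ≤ 1 + y := by
    intro M hM hMB
    have hM' : (0 : ℝ) < M := by positivity
    have hMB' : (M : ℝ) ≤ B * n := by exact_mod_cast hMB
    have h1 : δ * t ≤ (n : ℝ) ^ 2 * t / (M : ℝ) ^ 2 := by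
      rw [hδ_def, le_div_iff₀ (by positivity)]
      calc 1 / (B : ℝ) ^ 2 * t * (M : ℝ) ^ 2 ≤ 1 / (B : ℝ) ^ 2 * t * (B * n) ^ 2 := by gcongr
        _ = (n : ℝ) ^ 2 * t := by field_simp
    have h2 : δ ≤ (n : ℝ) ^ 2 * t / (M : ℝ) ^ 2 := (le_mul_of_one_le_right hδ.le ht).trans h1
    refine (cycleTheta_le hM hδ h2).trans ?_
    rw [hy_def]
    gcongr
    linarith
  have hα1 : ∀ i, 0 < α i * a := fun i => Nat.mul_pos (hα i) ha
  have hβ1 : ∀ i, 0 < β i * n := fun i => Nat.mul_pos (hβ i) hn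
  rw [torusTheta_eq_prod hpd]
  constructor
  · rw [sub_nonneg]
    refine one_le_mul_of_one_le_of_one_le ?_ ?_
    · exact Finset.prod_induction _ (fun x : ℝ => 1 ≤ x)
        (fun _ _ => one_le_mul_of_one_le_of_one_le) le_rfl fun i _ => one_le_cycleTheta (hα1 i) _
    · exact Finset.prod_induction _ (fun x : ℝ => 1 ≤ x)
        (fun _ _ => one_le_mul_of_one_le_of_one_le) le_rfl fun i _ => one_le_cycleTheta (hβ1 i) _
  · have hα2 : ∏ i, cycleTheta (α i * a) ((n : ℝ) ^ 2 * t) ≤ (1 + y) ^ p := by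
      refine (Finset.prod_le_prod
        (fun i _ => zero_le_one.trans (one_le_cycleTheta (hα1 i) _))
        fun i _ => hcycle _ (hα1 i) (Nat.mul_le_mul (hαB i) han)).trans_eq ?_
      simp
    have hβ2 : ∏ i, cycleTheta (β i * n) ((n : ℝ) ^ 2 * t) ≤ (1 + y) ^ (d - p) := by
      refine (Finset.prod_le_prod
        (fun i _ => zero_le_one.trans (one_le_cycleTheta (hβ1 i) _))
        fun i _ => hcycle _ (hβ1 i) (Nat.mul_le_mul_right n (hβB i))).trans_eq ?_
      simp
    have h3 := mul_le_mul hα2 hβ2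
      (Finset.prod_nonneg fun i _ => zero_le_one.trans (one_le_cycleTheta (hβ1 i) _))
      (by positivity)
    rw [← pow_add, Nat.add_sub_cancel' hpd] at h3
    have h4 := one_add_pow_sub_one_le hy hyK d
    rw [mul_assoc, ← hy_def]
    linarith

theorem torus_theta_integral_limit_large (d p : ℕ) (hp : 1 ≤ p) (hpd : p < d)
    (α : Fin p → ℕ) (hα : ∀ i, 0 < α i) (β : Fin (d - p) → ℕ) (hβ : ∀ i, 0 < β i)
    (a : ℕ → ℕ) (ha : ∀ n, 0 < a n)
    (hsub : Tendsto (fun n : ℕ => (a n : ℝ) / n) atTop (nhds 0)) :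
    Tendsto (fun n : ℕ =>
        ∫ t in Set.Ioi (1 : ℝ), (torusTheta d p α β (a n) n (n ^ 2 * t) - 1) / t)
      atTop
      (nhds (∫ t in Set.Ioi (1 : ℝ), (ThetaB d p β t - 1) / t)) := by
  obtain ⟨C, c, hc, hbound⟩ := exists_torusTheta_sub_one_le hpd.le hα hβ
  refine tendsto_integral_filter_of_dominated_convergence (fun t => C * Real.exp (-c * t))
    (Eventually.of_forall fun n => ?_) ?_ ((exp_neg_integrableOn_Ioi 1 hc).const_mul C) ?_
  · refine Measurable.aestronglyMeasurable ?_
    simp only [torusTheta]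
    fun_prop
  · filter_upwards [hsub.eventually_le_const zero_lt_one, eventually_gt_atTop 0] with n han hn
    refine ae_restrict_of_forall_mem measurableSet_Ioi fun t ht => ?_
    have ht1 : (1 : ℝ) ≤ t := (Set.mem_Ioi.1 ht).le
    have han' : a n ≤ n := by
      rw [div_le_one (by positivity)] at han
      exact_mod_cast han
    obtain ⟨h0, h1⟩ := hbound (a n) n (ha n) hn han' t ht1
    rw [Real.norm_of_nonneg (div_nonneg h0 (zero_le_one.trans ht1))]
    exact (div_le_self h0 ht1).trans h1
  · refine ae_restrict_of_forall_mem measurableSet_Ioi fun t ht => ?_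
    have ht0 : (0 : ℝ) < t := zero_lt_one.trans (Set.mem_Ioi.1 ht)
    refine Tendsto.div_const (Tendsto.sub_const ?_ 1) t
    rw [ThetaB_eq_prod hβ ht0, ← one_mul (∏ i, _), ← Finset.prod_const_one (s := Finset.univ (α := Fin p))]
    simp only [torusTheta_eq_prod hpd.le]
    refine (tendsto_finsetProd _ fun i _ => ?_).mul
      (tendsto_finsetProd _ fun i _ => tendsto_cycleTheta_linear (hβ i) ht0)
    refine tendsto_cycleTheta_sublinear (fun n => Nat.mul_pos (hα i) (ha n)) ?_ ht0
    have := hsub.const_mul (α i : ℝ)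
    rw [mul_zero] at this
    refine this.congr fun n => ?_
    push_cast
    ring
end

section
/- Let (a_n) be a sequence of positive integers with a_n/n → 0 as n → ∞. Then lim_{n→∞} ∫_1^∞ det(Λ_n)·e^{−2dn²t}·I_0(2n²t)^{d−p}·∑_{(k_1,…,k_p)∈ℤ^p} ∏_{i=1}^p I_{k_i α_i a_n}(2n²t) dt/t = (2/(d−p))·det(B)·(4π)^{−(d−p)/2}, where det(Λ_n) = a_n^p·n^{d−p}·α_1⋯α_p·β_1⋯β_{d−p} and det(B) = β_1⋯β_{d−p}. -/
open Real MeasureTheory Filter Finset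

/-- The modified `I`-Bessel function of integer order `m`. -/
noncomputable def besselI (m : ℤ) (t : ℝ) : ℝ :=
  (1 / (2 * π)) * ∫ θ in (-π)..π, Real.exp (t * Real.cos θ) * Real.cos (m * θ)

lemma intervalIntegral_odd_eq_zero {f : ℝ → ℝ} (hf : ∀ x, f (-x) = -f x) (c : ℝ) :
    ∫ x in (-c)..c, f x = 0 := by
  have h := intervalIntegral.integral_comp_neg (a := -c) (b := c) f
  simp only [hf, intervalIntegral.integral_neg, neg_neg] at h
  linarith

/-- The function `θ ↦ exp (u cos θ)` on the circle. -/
noncomputable def expMulCos (u : ℝ) : C(AddCircle (2 * π), ℂ) where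
  toFun := fun θ : Real.Angle => ((Real.exp (u * Real.Angle.cos (θ : Real.Angle)) : ℝ) : ℂ)
  continuous_toFun := by
    exact Complex.continuous_ofReal.comp
      (Real.continuous_exp.comp (continuous_const.mul Real.Angle.continuous_cos))

lemma expMulCos_coe (u x : ℝ) : expMulCos u (x : AddCircle (2 * π)) =
    ((Real.exp (u * Real.cos x) : ℝ) : ℂ) := rfl

instance fact_two_pi_pos : Fact (0 < 2 * π) := ⟨Real.two_pi_pos⟩

lemma fourierCoeff_expMulCos (u : ℝ) (m : ℤ) :
    fourierCoeff (expMulCos u) m = (besselI m u : ℂ) := by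
  have hodd : ∫ x in (-π)..π, Real.exp (u * Real.cos x) * Real.sin (m * x) = 0 :=
    intervalIntegral_odd_eq_zero (by intro x; simp) π
  have hpt : ∀ x : ℝ, fourier (-m) (x : AddCircle (2 * π)) • expMulCos u x =
      ((Real.exp (u * Real.cos x) * Real.cos (m * x) : ℝ) : ℂ) -
        Complex.I * ((Real.exp (u * Real.cos x) * Real.sin (m * x) : ℝ) : ℂ) := by
    intro x
    have hπ : (π : ℂ) ≠ 0 := by exact_mod_cast Real.pi_ne_zero
    rw [fourier_coe_apply, expMulCos_coe,
      show 2 * (π : ℂ) * Complex.I * ((-m : ℤ) : ℂ) * x / ((2 * π : ℝ) : ℂ) =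
        ((-(m * x) : ℝ) : ℂ) * Complex.I by push_cast; field_simp]
    rw [Complex.exp_mul_I, ← Complex.ofReal_cos, ← Complex.ofReal_sin, Real.cos_neg, Real.sin_neg]
    simp only [smul_eq_mul]
    push_cast
    ring
  rw [fourierCoeff_eq_intervalIntegral _ _ (-π), show -π + 2 * π = π by ring]
  simp_rw [hpt]
  rw [intervalIntegral.integral_sub, intervalIntegral.integral_const_mul,
    intervalIntegral.integral_ofReal, intervalIntegral.integral_ofReal, hodd, besselI]
  · simp
  · exact Continuous.intervalIntegrable (by fun_prop) _ _
  · exact Continuous.intervalIntegrable (by fun_prop) _ _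

lemma sq_mul_besselI (u : ℝ) (m : ℤ) : (m : ℝ) ^ 2 * besselI m u =
    -((1 / (2 * π)) * ∫ θ in (-π)..π,
      ((u * Real.sin θ) ^ 2 - u * Real.cos θ) * Real.exp (u * Real.cos θ) * Real.cos (m * θ)) := by
  have hf : ∀ x, HasDerivAt (fun θ : ℝ => Real.exp (u * Real.cos θ))
      (Real.exp (u * Real.cos x) * (u * -Real.sin x)) x := fun x =>
    ((Real.hasDerivAt_cos x).const_mul u).exp
  have hf' : ∀ x, HasDerivAt (fun θ : ℝ => Real.exp (u * Real.cos θ) * (u * -Real.sin θ))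
      (((u * Real.sin x) ^ 2 - u * Real.cos x) * Real.exp (u * Real.cos x)) x := by
    intro x
    convert! (hf x).mul ((Real.hasDerivAt_sin x).fun_neg.const_mul u) using 1
    ring
  have hs : ∀ x : ℝ, HasDerivAt (fun θ : ℝ => Real.sin (m * θ)) (m * Real.cos (m * x)) x := by
    intro x
    convert! ((hasDerivAt_id x).const_mul (m : ℝ)).sin using 1
    simp [mul_comm]
  have hc : ∀ x : ℝ, HasDerivAt (fun θ : ℝ => -Real.cos (m * θ)) (m * Real.sin (m * x)) x := by
    intro x
    convert! ((hasDerivAt_id x).const_mul (m : ℝ)).cos.neg using 1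
    simp [mul_comm]
  have h1 := intervalIntegral.integral_mul_deriv_eq_deriv_mul (a := -π) (b := π)
    (fun x _ => hf x) (fun x _ => hs x)
    (Continuous.intervalIntegrable (by fun_prop) _ _)
    (Continuous.intervalIntegrable (by fun_prop) _ _)
  have h2 := intervalIntegral.integral_mul_deriv_eq_deriv_mul (a := -π) (b := π)
    (fun x _ => hf' x) (fun x _ => hc x)
    (Continuous.intervalIntegrable (by fun_prop) _ _)
    (Continuous.intervalIntegrable (by fun_prop) _ _)
  simp only [mul_neg, Real.sin_neg, Real.sin_int_mul_pi, Real.sin_pi, neg_zero, mul_zero,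
    sub_zero, zero_sub, zero_mul] at h1 h2
  simp only [intervalIntegral.integral_neg, neg_neg] at h1 h2
  have e1 : (∫ x in (-π)..π, Real.exp (u * Real.cos x) * (m * Real.cos (m * x))) =
      m * ∫ x in (-π)..π, Real.exp (u * Real.cos x) * Real.cos (m * x) := by
    rw [← intervalIntegral.integral_const_mul]; congr 1; ext; ring
  have e2 : (∫ x in (-π)..π, -(Real.exp (u * Real.cos x) * (u * Real.sin x)) * (m * Real.sin (m * x))) =
      m * ∫ x in (-π)..π, -(Real.exp (u * Real.cos x) * (u * Real.sin x)) * Real.sin (m * x) := by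
    rw [← intervalIntegral.integral_const_mul]; congr 1; ext; ring
  simp only [neg_mul, intervalIntegral.integral_neg] at h1 h2 e1 e2
  rw [besselI]
  linear_combination (-(m : ℝ) * e1 + e2 + m * h1 - h2) / (2 * π)

lemma summable_besselI (u : ℝ) : Summable fun m : ℤ => besselI m u := by
  have hb : ∃ K, ∀ m : ℤ, |(m : ℝ) ^ 2 * besselI m u| ≤ K := by
    refine ⟨(1 / (2 * π)) * (((u ^ 2 + |u|) * Real.exp |u|) * |π - -π|), fun m => ?_⟩
    rw [sq_mul_besselI, abs_neg, abs_mul, abs_of_pos (by positivity : 0 < 1 / (2 * π))]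
    gcongr
    rw [← Real.norm_eq_abs (∫ θ in (-π)..π, _)]
    refine intervalIntegral.norm_integral_le_of_norm_le_const fun x _ => ?_
    have h1 : |(u * Real.sin x) ^ 2 - u * Real.cos x| ≤ u ^ 2 + |u| := by
      refine (abs_sub _ _).trans (add_le_add ?_ ?_)
      · rw [abs_of_nonneg (sq_nonneg _), mul_pow]
        exact mul_le_of_le_one_right (sq_nonneg _) (Real.sin_sq_le_one x)
      · rw [abs_mul]
        exact mul_le_of_le_one_right (abs_nonneg _) (Real.abs_cos_le_one x)
    have h2 : Real.exp (u * Real.cos x) ≤ Real.exp |u| := by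
      refine Real.exp_le_exp.mpr ((le_abs_self _).trans ?_)
      rw [abs_mul]
      exact mul_le_of_le_one_right (abs_nonneg _) (Real.abs_cos_le_one x)
    rw [Real.norm_eq_abs, abs_mul, abs_mul, abs_of_pos (Real.exp_pos _)]
    refine mul_le_of_le_one_right (by positivity) (Real.abs_cos_le_one _) |>.trans ?_
    gcongr
  obtain ⟨K, hK⟩ := hb
  refine Summable.of_norm_bounded_eventually
    ((Real.summable_one_div_int_pow.mpr one_lt_two).mul_left K) ?_
  filter_upwards [(Set.finite_singleton (0 : ℤ)).compl_mem_cofinite] with m hm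
  have hm0 : (0 : ℝ) < (m : ℝ) ^ 2 := by
    have : (m : ℝ) ≠ 0 := by exact_mod_cast hm
    positivity
  have := hK m
  rw [abs_mul, abs_of_pos hm0] at this
  rw [Real.norm_eq_abs, mul_one_div, le_div_iff₀ hm0]
  linarith

lemma hasSum_besselI_fourier (u x : ℝ) : HasSum
    (fun m : ℤ => (besselI m u : ℂ) * Complex.exp (m * x * Complex.I))
    ((Real.exp (u * Real.cos x) : ℝ) : ℂ) := by
  have hs : Summable (fourierCoeff (expMulCos u)) := by
    rw [funext (fourierCoeff_expMulCos u)]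
    exact Complex.ofRealCLM.summable (summable_besselI u)
  have h := has_pointwise_sum_fourier_series_of_summable hs (x : AddCircle (2 * π))
  rw [expMulCos_coe] at h
  refine h.congr_fun ?_ 
  intro m
  have hπ : (π : ℂ) ≠ 0 := by exact_mod_cast Real.pi_ne_zero
  rw [fourierCoeff_expMulCos, fourier_coe_apply, smul_eq_mul]
  congr 2
  push_cast
  field_simp

lemma sum_exp_eq_ite {M : ℕ} (hM : 0 < M) (m : ℤ) :
    ∑ j ∈ range M, Complex.exp (m * ((2 * π * (j / M) : ℝ) : ℂ) * Complex.I) =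
      if (M : ℤ) ∣ m then (M : ℂ) else 0 := by
  have hM0 : (M : ℂ) ≠ 0 := by exact_mod_cast hM.ne'
  set ζ := Complex.exp (2 * π * Complex.I * (m / M)) with hζ
  have hj : ∀ j : ℕ, Complex.exp (m * ((2 * π * (j / M) : ℝ) : ℂ) * Complex.I) = ζ ^ j := by
    intro j
    rw [hζ, ← Complex.exp_nat_mul]
    congr 1
    push_cast
    ring
  simp_rw [hj]
  split_ifs with h
  · obtain ⟨k, rfl⟩ := h
    have : ζ = 1 := by
      rw [hζ, Complex.exp_eq_one_iff]
      exact ⟨k, by push_cast; field_simp⟩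
    simp [this]
  · have h1 : ζ ^ M = 1 := by
      rw [hζ, ← Complex.exp_nat_mul, Complex.exp_eq_one_iff]
      exact ⟨m, by field_simp⟩
    have h2 : ζ ≠ 1 := by
      intro h1
      rw [hζ, Complex.exp_eq_one_iff] at h1
      obtain ⟨k, hk⟩ := h1
      apply h
      refine ⟨k, ?_⟩
      have h3 : (m : ℂ) / M = k := by
        have : (2 * π * Complex.I : ℂ) ≠ 0 := Complex.two_pi_I_ne_zero
        apply mul_left_cancel₀ this
        rw [hk]; ring
      rw [div_eq_iff hM0] at h3
      have h4 : (m : ℂ) = ((M * k : ℤ) : ℂ) := by rw [h3]; push_cast; ring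
      exact_mod_cast h4
    have := mul_geom_sum ζ M
    rw [h1, sub_self] at this
    exact (mul_eq_zero.mp this).resolve_left (sub_ne_zero.mpr h2)

/-- The heat kernel trace of the discrete circle `ℤ / M`. -/
noncomputable def circleTheta (M : ℕ) (u : ℝ) : ℝ :=
  ∑ j ∈ range M, Real.exp (-(u * (1 - Real.cos (2 * π * (j / M)))))

lemma hasSum_besselI_mul {M : ℕ} (hM : 0 < M) (u : ℝ) :
    HasSum (fun k : ℤ => M * (Real.exp (-u) * besselI (k * M) u)) (circleTheta M u) := by
  have h := hasSum_sum (s := range M) fun j _ =>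
    hasSum_besselI_fourier u (2 * π * (j / M))
  simp_rw [← Finset.mul_sum, sum_exp_eq_ite hM] at h
  have hinj : Function.Injective fun k : ℤ => k * (M : ℤ) :=
    mul_left_injective₀ (by exact_mod_cast hM.ne')
  rw [← hinj.hasSum_iff] at h
  · have h2 : HasSum (fun k : ℤ => ((besselI (k * M) u * M : ℝ) : ℂ))
        ((∑ j ∈ range M, Real.exp (u * Real.cos (2 * π * (j / M))) : ℝ) : ℂ) := by
      convert! h using 1
      · ext k; simp
      · push_cast; rfl
    have h3 := (Complex.hasSum_ofReal.mp h2).mul_left (Real.exp (-u))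
    convert! h3 using 1
    · ext k; ring
    · rw [circleTheta, Finset.mul_sum]
      refine Finset.sum_congr rfl fun j _ => ?_
      rw [← Real.exp_add]
      congr 1; ring
  · intro m hm
    rw [if_neg, mul_zero]
    rintro ⟨k, rfl⟩
    exact hm ⟨k, mul_comm _ _⟩

lemma hasSum_pi_prod {ι : Type*} {p : ℕ} {f : Fin p → ι → ℝ} {s : Fin p → ℝ}
    (h : ∀ i, HasSum (f i) (s i)) :
    HasSum (fun k : Fin p → ι => ∏ i, f i (k i)) (∏ i, s i) := by
  induction p with
  | zero => simp
  | succ p ih =>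
    have ih : HasSum (fun k : Fin p → ι => ∏ i : Fin p, f i.succ (k i)) (∏ i : Fin p, s i.succ) :=
      ih (f := fun i => f i.succ) (s := fun i => s i.succ) fun i => h i.succ
    have h0 : Summable fun k => ‖f 0 k‖ := (h 0).summable.norm
    have h1 : Summable fun k : Fin p → ι => ‖∏ i : Fin p, f i.succ (k i)‖ := ih.summable.norm
    have hsum := summable_mul_of_summable_norm h0 h1
    have hm := (h 0).mul ih hsum
    rw [← Fin.prod_univ_succ] at hm
    refine (Fin.consEquiv fun _ : Fin (p + 1) => ι).hasSum_iff.mp (hm.congr_fun fun x => ?_)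
    simp [Fin.prod_univ_succ, Fin.consEquiv]

lemma continuous_besselI (m : ℤ) : Continuous (besselI m) := by
  unfold besselI
  exact continuous_const.mul
    (intervalIntegral.continuous_parametric_intervalIntegral_of_continuous' (by fun_prop) _ _)

lemma besselI_zero_nonneg (u : ℝ) : 0 ≤ besselI 0 u := by
  unfold besselI
  refine mul_nonneg (by positivity) (intervalIntegral.integral_nonneg (by linarith [pi_pos]) ?_)
  intro x _
  simpa using (Real.exp_pos _).le

/-- The normalised Bessel function `√u e⁻ᵘ I₀(u)`. -/
noncomputable def scaledBessel (u : ℝ) : ℝ := √u * (Real.exp (-u) * besselI 0 u)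

lemma continuous_scaledBessel : Continuous scaledBessel :=
  Real.continuous_sqrt.mul ((by fun_prop : Continuous fun u : ℝ => Real.exp (-u)).mul
    (continuous_besselI 0))

lemma scaledBessel_nonneg (u : ℝ) : 0 ≤ scaledBessel u := by
  have := besselI_zero_nonneg u
  unfold scaledBessel
  positivity

lemma scaledBessel_eq_integral {u : ℝ} (hu : 0 < u) : scaledBessel u =
    (1 / (2 * π)) * ∫ x : ℝ, (Set.Ioc (-(π * √u)) (π * √u)).indicator
      (fun x => Real.exp (-(u * (1 - Real.cos (x / √u))))) x := by
  have hs : √u ≠ 0 := (Real.sqrt_pos.mpr hu).ne'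
  have h := intervalIntegral.integral_comp_div (a := -(π * √u)) (b := π * √u)
    (fun θ => Real.exp (-(u * (1 - Real.cos θ)))) hs
  rw [neg_div, mul_div_cancel_right₀ _ hs] at h
  rw [integral_indicator measurableSet_Ioc, ← intervalIntegral.integral_of_le
    (by have : 0 ≤ π * √u := by positivity
        linarith), h, scaledBessel, besselI]
  have e : ∀ θ : ℝ, Real.exp (-(u * (1 - Real.cos θ))) =
      Real.exp (-u) * (Real.exp (u * Real.cos θ) * Real.cos ((0 : ℤ) * θ)) := by
    intro θ
    rw [Int.cast_zero, zero_mul, Real.cos_zero, mul_one, ← Real.exp_add]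
    congr 1; ring
  simp_rw [e, intervalIntegral.integral_const_mul, smul_eq_mul]
  ring

lemma indicator_exp_neg_one_sub_cos_le {u : ℝ} (hu : 0 < u) (x : ℝ) :
    (Set.Ioc (-(π * √u)) (π * √u)).indicator
      (fun x => Real.exp (-(u * (1 - Real.cos (x / √u))))) x ≤
      Real.exp (-(2 / π ^ 2) * x ^ 2) := by
  have hs : 0 < √u := Real.sqrt_pos.mpr hu
  by_cases hx : x ∈ Set.Ioc (-(π * √u)) (π * √u)
  · rw [Set.indicator_of_mem hx, Real.exp_le_exp]
    have hx' : |x / √u| ≤ π := by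
      rw [abs_div, abs_of_pos hs, div_le_iff₀ hs, abs_le]
      exact ⟨hx.1.le, hx.2⟩
    have h := Real.cos_le_one_sub_mul_cos_sq hx'
    have h2 : u * (2 / π ^ 2 * (x / √u) ^ 2) = 2 / π ^ 2 * x ^ 2 := by
      rw [div_pow, Real.sq_sqrt hu.le]
      field_simp
    nlinarith [mul_le_mul_of_nonneg_left h hu.le]
  · rw [Set.indicator_of_notMem hx]
    positivity

lemma scaledBessel_le {u : ℝ} (hu : 0 < u) :
    scaledBessel u ≤ (1 / (2 * π)) * ∫ x : ℝ, Real.exp (-(2 / π ^ 2) * x ^ 2) := by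
  rw [scaledBessel_eq_integral hu]
  refine mul_le_mul_of_nonneg_left ?_ (by positivity)
  refine integral_mono_of_nonneg (.of_forall fun x => Set.indicator_nonneg (fun _ _ => ?_) x)
    (integrable_exp_neg_mul_sq (by positivity))
    (.of_forall (indicator_exp_neg_one_sub_cos_le hu))
  positivity

lemma mul_one_sub_cos_div_sqrt {u : ℝ} (hu : 0 < u) (x : ℝ) :
    u * (1 - Real.cos (x / √u)) = x ^ 2 / 2 * Real.sinc (x / √u / 2) ^ 2 := by
  have hs : 0 < √u := Real.sqrt_pos.mpr hu
  rcases eq_or_ne x 0 with rfl | hx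
  · simp
  have hc : Real.cos (x / √u) = 1 - 2 * Real.sin (x / √u / 2) ^ 2 := by
    rw [← Real.cos_sq_add_sin_sq (x / √u / 2)]
    conv_lhs => rw [show x / √u = 2 * (x / √u / 2) by ring, Real.cos_two_mul']
    ring
  have hne : x / √u / 2 ≠ 0 := by positivity
  rw [Real.sinc_of_ne_zero hne, hc]
  field_simp
  rw [Real.sq_sqrt hu.le]
  ring

lemma tendsto_scaledBessel : Tendsto scaledBessel atTop (nhds (1 / √(2 * π))) := by
  have key : Tendsto (fun u : ℝ => (1 / (2 * π)) * ∫ x : ℝ,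
      (Set.Ioc (-(π * √u)) (π * √u)).indicator
        (fun x => Real.exp (-(u * (1 - Real.cos (x / √u))))) x) atTop
      (nhds ((1 / (2 * π)) * ∫ x : ℝ, Real.exp (-(1 / 2) * x ^ 2))) := by
    refine Tendsto.const_mul _ (tendsto_integral_filter_of_dominated_convergence
      (fun x => Real.exp (-(2 / π ^ 2) * x ^ 2)) ?_ ?_
      (integrable_exp_neg_mul_sq (by positivity)) ?_)
    · refine .of_forall fun u => Measurable.aestronglyMeasurable ?_
      exact Measurable.indicator (by fun_prop) measurableSet_Ioc
    · filter_upwards [eventually_gt_atTop 0] with u hu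
      refine .of_forall fun x => ?_
      rw [Real.norm_of_nonneg (Set.indicator_nonneg (fun _ _ => (Real.exp_pos _).le) x)]
      exact indicator_exp_neg_one_sub_cos_le hu x
    · refine .of_forall fun x => ?_
      have h0 : Tendsto (fun u : ℝ => x / √u / 2) atTop (nhds 0) := by
        simpa using (Real.tendsto_sqrt_atTop.const_div_atTop x).div_const 2
      have h1 := (Real.continuous_sinc.tendsto 0).comp h0
      have h2 : Tendsto (fun u : ℝ => Real.exp (-(x ^ 2 / 2 * Real.sinc (x / √u / 2) ^ 2))) atTop
          (nhds (Real.exp (-(1 / 2) * x ^ 2))) := by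
        rw [Real.sinc_zero] at h1
        have h3 := ((h1.pow 2).const_mul (x ^ 2 / 2)).neg
        rw [show -(x ^ 2 / 2 * 1 ^ 2) = -(1 / 2) * x ^ 2 by ring] at h3
        exact (Real.continuous_exp.tendsto _).comp h3
      refine h2.congr' ?_
      have hlarge : ∀ᶠ u : ℝ in atTop, |x| < π * √u :=
        (Real.tendsto_sqrt_atTop.const_mul_atTop pi_pos).eventually_gt_atTop _
      filter_upwards [eventually_gt_atTop 0, hlarge] with u hu hx
      rw [abs_lt] at hx
      rw [Set.indicator_of_mem (Set.mem_Ioc.mpr ⟨hx.1, hx.2.le⟩), mul_one_sub_cos_div_sqrt hu]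
  rw [integral_gaussian] at key
  have e : (1 / (2 * π)) * √(π / (1 / 2)) = 1 / √(2 * π) := by
    rw [show π / (1 / 2) = 2 * π by ring]
    have := Real.sq_sqrt (by positivity : 0 ≤ 2 * π)
    have hne : √(2 * π) ≠ 0 := by positivity
    field_simp
    linarith
  rw [e] at key
  refine key.congr' ?_
  filter_upwards [eventually_gt_atTop 0] with u hu
  exact (scaledBessel_eq_integral hu).symm

lemma exp_neg_one_sub_cos_le {u x : ℝ} (hu : 0 ≤ u) (hx0 : 0 ≤ x) (hx1 : x ≤ 1) :
    Real.exp (-(u * (1 - Real.cos (2 * π * x)))) ≤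
      Real.exp (-(8 * u * x ^ 2)) + Real.exp (-(8 * u * (1 - x) ^ 2)) := by
  have hcos : ∀ y : ℝ, 0 ≤ y → y ≤ 1 / 2 → Real.cos (2 * π * y) ≤ 1 - 8 * y ^ 2 := by
    intro y h0 h1
    have h := Real.cos_le_one_sub_mul_cos_sq (x := 2 * π * y) (by
      rw [abs_of_nonneg (by positivity)]
      nlinarith [pi_pos])
    have e : 2 / π ^ 2 * (2 * π * y) ^ 2 = 8 * y ^ 2 := by field_simp; ring
    linarith
  rcases le_total x (1 / 2) with h | h
  · refine le_add_of_le_of_nonneg (Real.exp_le_exp.mpr ?_) (Real.exp_pos _).le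
    nlinarith [mul_le_mul_of_nonneg_left (hcos x hx0 h) hu]
  · refine le_add_of_nonneg_of_le (Real.exp_pos _).le (Real.exp_le_exp.mpr ?_)
    have h2 := hcos (1 - x) (by linarith) (by linarith)
    rw [show 2 * π * (1 - x) = 2 * π - 2 * π * x by ring, Real.cos_two_pi_sub] at h2
    nlinarith [mul_le_mul_of_nonneg_left h2 hu]

lemma continuous_circleTheta (M : ℕ) : Continuous (circleTheta M) := by
  unfold circleTheta
  fun_prop

lemma circleTheta_antitone (M : ℕ) : Antitone (circleTheta M) := by
  intro u v huv
  refine Finset.sum_le_sum fun j _ => Real.exp_le_exp.mpr (neg_le_neg ?_)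
  exact mul_le_mul_of_nonneg_right huv (sub_nonneg.mpr (Real.cos_le_one _))

lemma one_le_circleTheta {M : ℕ} (hM : 0 < M) (u : ℝ) : 1 ≤ circleTheta M u := by
  have h := Finset.single_le_sum (f := fun j : ℕ =>
      Real.exp (-(u * (1 - Real.cos (2 * π * (j / M)))))) (s := range M)
    (fun j _ => (Real.exp_pos _).le) (Finset.mem_range.mpr hM)
  unfold circleTheta
  simpa using h

lemma circleTheta_le {M : ℕ} (hM : 0 < M) {u : ℝ} (hu : 0 < u) :
    circleTheta M u ≤ 1 + 2 * (Real.exp (-(8 * u / M ^ 2)) / (1 - Real.exp (-(8 * u / M ^ 2)))) := by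
  obtain ⟨N, rfl⟩ := Nat.exists_eq_succ_of_ne_zero hM.ne'
  set q := Real.exp (-(8 * u / ((N.succ : ℕ) : ℝ) ^ 2)) with hq
  have hq0 : 0 < q := Real.exp_pos _
  have hq1 : q < 1 := by
    rw [hq, Real.exp_lt_one_iff, neg_lt_zero]
    positivity
  have hN : (0 : ℝ) < (N : ℝ) + 1 := by positivity
  have hpow : ∀ l : ℕ, Real.exp (-(8 * u * ((l : ℝ) / (N + 1)) ^ 2)) ≤ q ^ l := by
    intro l
    calc Real.exp (-(8 * u * ((l : ℝ) / (N + 1)) ^ 2)) = q ^ (l ^ 2) := by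
          rw [hq, ← Real.exp_nat_mul]
          congr 1
          push_cast
          field_simp
      _ ≤ q ^ l := pow_le_pow_of_le_one hq0.le hq1.le (Nat.le_self_pow two_ne_zero l)
  have hgeom : ∑ j ∈ range N, q ^ (j + 1) ≤ q / (1 - q) := by
    rw [le_div_iff₀ (by linarith)]
    simp_rw [pow_succ]
    rw [← Finset.sum_mul]
    have := geom_sum_mul q N
    nlinarith [pow_pos hq0 N]
  have hterm : ∀ j ∈ range N, Real.exp (-(u * (1 - Real.cos (2 * π *
      (((j + 1 : ℕ) : ℝ) / (N.succ : ℕ)))))) ≤ q ^ (j + 1) + q ^ (N - 1 - j + 1) := by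
    intro j hj
    have hj := Finset.mem_range.mp hj
    have hjN : (j : ℝ) + 1 ≤ N := by exact_mod_cast hj
    have hx1 : (((j + 1 : ℕ) : ℝ) / (N.succ : ℕ)) ≤ 1 := by
      rw [div_le_one (by positivity)]
      push_cast
      linarith
    refine (exp_neg_one_sub_cos_le hu.le (by positivity) hx1).trans (add_le_add ?_ ?_)
    · simpa using hpow (j + 1)
    · have e : 1 - ((j + 1 : ℕ) : ℝ) / (N.succ : ℕ) = ((N - 1 - j + 1 : ℕ) : ℝ) / (N + 1) := by
        rw [show N - 1 - j + 1 = N - j by omega, Nat.cast_sub hj.le]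
        push_cast
        field_simp
        ring
      rw [e]
      exact hpow _
  have hsum := Finset.sum_le_sum hterm
  rw [Finset.sum_add_distrib, Finset.sum_range_reflect (fun j => q ^ (j + 1)) N] at hsum
  rw [circleTheta, Finset.sum_range_succ']
  simp only [Nat.cast_zero, zero_div, mul_zero, Real.cos_zero, sub_self, neg_zero, Real.exp_zero]
  linarith

lemma tendsto_circleTheta {M : ℕ → ℕ} (hM : ∀ n, 0 < M n)
    (hlim : Tendsto (fun n : ℕ => (M n : ℝ) / n) atTop (nhds 0)) :
    Tendsto (fun n : ℕ => circleTheta (M n) (2 * n ^ 2)) atTop (nhds 1) := by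
  have h1 : Tendsto (fun n : ℕ => (n : ℝ) / M n) atTop atTop := by
    have : Tendsto (fun n : ℕ => (M n : ℝ) / n) atTop (nhdsWithin 0 (Set.Ioi 0)) := by
      refine tendsto_nhdsWithin_iff.mpr ⟨hlim, ?_⟩
      filter_upwards [eventually_gt_atTop 0] with n hn
      have := hM n
      exact Set.mem_Ioi.mpr (by positivity)
    simpa only [Pi.inv_def, inv_div] using this.inv_tendsto_nhdsGT_zero
  have h2 : Tendsto (fun n : ℕ => Real.exp (-(8 * (2 * (n : ℝ) ^ 2) / (M n) ^ 2))) atTop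
      (nhds 0) := by
    refine Real.tendsto_exp_neg_atTop_nhds_zero.comp ?_
    have := ((tendsto_pow_atTop two_ne_zero).comp h1).const_mul_atTop (by norm_num : (0 : ℝ) < 16)
    refine this.congr fun n => ?_
    simp only [Function.comp_apply, div_pow]
    ring
  have h3 : Tendsto (fun n : ℕ => 1 + 2 * (Real.exp (-(8 * (2 * (n : ℝ) ^ 2) / (M n) ^ 2)) /
      (1 - Real.exp (-(8 * (2 * (n : ℝ) ^ 2) / (M n) ^ 2))))) atTop (nhds 1) := by
    simpa using ((h2.div (h2.const_sub 1) (by norm_num)).const_mul 2).const_add 1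
  refine tendsto_of_tendsto_of_tendsto_of_le_of_le' tendsto_const_nhds h3
    (.of_forall fun n => one_le_circleTheta (hM n) _) ?_
  filter_upwards [eventually_gt_atTop 0] with n hn
  exact circleTheta_le (hM n) (by positivity)

lemma one_div_sqrt_pow {x : ℝ} (hx : 0 < x) (k : ℕ) : (1 / √x) ^ k = x ^ (-(k : ℝ) / 2) := by
  rw [Real.sqrt_eq_rpow, one_div, ← Real.rpow_neg hx.le, ← Real.rpow_natCast, ← Real.rpow_mul hx.le]
  congr 1
  ring

lemma div_sqrt_two_mul_pow_div (c : ℝ) {t : ℝ} (ht : 0 < t) (k : ℕ) :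
    (c / √(2 * t)) ^ k / t = (c / √2) ^ k * t ^ (-(k : ℝ) / 2 - 1) := by
  rw [Real.rpow_sub_one ht.ne', ← one_div_sqrt_pow ht, Real.sqrt_mul zero_le_two, ← div_div,
    div_eq_mul_one_div (c / √2), mul_pow, mul_div_assoc]

lemma prod_mul_tsum_besselI {p : ℕ} {M : Fin p → ℕ} (hM : ∀ i, 0 < M i) (u : ℝ) :
    (∏ i, (M i : ℝ)) * (Real.exp (-u) ^ p *
      ∑' k : Fin p → ℤ, ∏ i, besselI (k i * M i) u) = ∏ i, circleTheta (M i) u := by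
  rw [← (hasSum_pi_prod fun i => hasSum_besselI_mul (hM i) u).tsum_eq, ← mul_assoc, ← tsum_mul_left]
  refine tsum_congr fun k => ?_
  simp [Finset.prod_mul_distrib, mul_assoc]

lemma mul_exp_mul_besselI_zero {n t : ℝ} (hn : 0 < n) (ht : 0 < t) :
    n * (Real.exp (-(2 * n ^ 2 * t)) * besselI 0 (2 * n ^ 2 * t)) =
      scaledBessel (2 * n ^ 2 * t) / √(2 * t) := by
  have hne : √(2 * t) ≠ 0 := by positivity
  rw [scaledBessel, show 2 * n ^ 2 * t = n ^ 2 * (2 * t) by ring, Real.sqrt_mul (sq_nonneg n),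
    Real.sqrt_sq hn.le, eq_div_iff hne]
  ring

lemma bessel_integrand_eq {k p : ℕ} {α : Fin p → ℕ} (hα : ∀ i, 0 < α i) {a : ℕ} (ha : 0 < a)
    (b : ℝ) {n t : ℝ} (hn : 0 < n) (ht : 0 < t) :
    ((a : ℝ) ^ p * n ^ k * (∏ i, (α i : ℝ)) * b) *
        Real.exp (-(2 * ((k : ℝ) + p)) * n ^ 2 * t) * (besselI 0 (2 * n ^ 2 * t)) ^ k *
        (∑' l : Fin p → ℤ, ∏ i, besselI (l i * α i * a) (2 * n ^ 2 * t)) / t =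
      b * ((scaledBessel (2 * n ^ 2 * t) / √(2 * t)) ^ k / t) *
        ∏ i, circleTheta (α i * a) (2 * n ^ 2 * t) := by
  rw [← prod_mul_tsum_besselI (fun i => mul_pos (hα i) ha), ← mul_exp_mul_besselI_zero hn ht]
  have e : Real.exp (-(2 * ((k : ℝ) + p)) * n ^ 2 * t) =
      Real.exp (-(2 * n ^ 2 * t)) ^ k * Real.exp (-(2 * n ^ 2 * t)) ^ p := by
    rw [← pow_add, ← Real.exp_nat_mul]
    congr 1
    push_cast
    ring
  have e2 : ∏ i, ((α i * a : ℕ) : ℝ) = (∏ i, (α i : ℝ)) * (a : ℝ) ^ p := by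
    simp [Finset.prod_mul_distrib]
  rw [e, e2]
  push_cast
  simp only [mul_assoc, mul_pow]
  ring

lemma integral_Ioi_one_rpow {k : ℕ} (hk : 0 < k) :
    ∫ t in Set.Ioi (1 : ℝ), t ^ (-(k : ℝ) / 2 - 1) = 2 / k := by
  have hk' : (0 : ℝ) < k := by exact_mod_cast hk
  rw [integral_Ioi_rpow_of_lt (by linarith) one_pos, Real.one_rpow, sub_add_cancel]
  field_simp

theorem torus_bessel_integral_limit_large (d p : ℕ) (hp : 1 ≤ p) (hpd : p < d)
    (α : Fin p → ℕ) (hα : ∀ i, 0 < α i) (β : Fin (d - p) → ℕ) (hβ : ∀ i, 0 < β i)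
    (a : ℕ → ℕ) (ha : ∀ n, 0 < a n)
    (hsub : Tendsto (fun n : ℕ => (a n : ℝ) / n) atTop (nhds 0)) :
    Tendsto (fun n : ℕ =>
        ∫ t in Set.Ioi (1 : ℝ),
          ((a n : ℝ) ^ p * (n : ℝ) ^ (d - p) * (∏ i, (α i : ℝ)) * ∏ i, (β i : ℝ)) *
            Real.exp (-(2 * d) * n ^ 2 * t) * (besselI 0 (2 * n ^ 2 * t)) ^ (d - p) *
            (∑' k : Fin p → ℤ, ∏ i, besselI (k i * α i * a n) (2 * n ^ 2 * t)) / t)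
      atTop
      (nhds ((2 / ((d : ℝ) - p)) * (∏ i, (β i : ℝ)) *
        (4 * π) ^ (-(((d - p : ℕ) : ℝ)) / 2))) := by
  obtain ⟨k, rfl⟩ := Nat.exists_eq_add_of_lt hpd
  generalize hb : ∏ i, (β i : ℝ) = b
  rw [show p + k + 1 - p = k + 1 by omega]
  have hb0 : 0 ≤ b := hb ▸ Finset.prod_nonneg fun i _ => Nat.cast_nonneg _
  have hk : (0 : ℝ) < ((k + 1 : ℕ) : ℝ) := by positivity
  have hM : ∀ i n, 0 < α i * a n := fun i n => mul_pos (hα i) (ha n)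
  have hMlim : ∀ i, Tendsto (fun n : ℕ => ((α i * a n : ℕ) : ℝ) / n) atTop (nhds 0) := by
    intro i
    have := hsub.const_mul (α i : ℝ)
    rw [mul_zero] at this
    exact this.congr fun n => by push_cast; ring
  have hT := fun i => tendsto_circleTheta (hM i) (hMlim i)
  obtain ⟨C, hC⟩ : ∃ C, ∀ u, 0 < u → scaledBessel u ≤ C := ⟨_, fun u hu => scaledBessel_le hu⟩
  have hmono : ∀ (n : ℕ) (t : ℝ), 1 < t → 2 * (n : ℝ) ^ 2 ≤ 2 * n ^ 2 * t := fun n t ht =>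
    le_mul_of_one_le_right (by positivity) ht.le
  have key : Tendsto (fun n : ℕ => ∫ t in Set.Ioi (1 : ℝ),
      b * ((scaledBessel (2 * n ^ 2 * t) / √(2 * t)) ^ (k + 1) / t) *
        ∏ i, circleTheta (α i * a n) (2 * n ^ 2 * t)) atTop
      (nhds (∫ t in Set.Ioi (1 : ℝ), b * ((1 / √(2 * π) / √(2 * t)) ^ (k + 1) / t) *
        ∏ _i : Fin p, 1)) := by
    refine tendsto_integral_filter_of_dominated_convergence
      (fun t => b * ((C / √2) ^ (k + 1) * t ^ (-((k + 1 : ℕ) : ℝ) / 2 - 1)) * ∏ _i : Fin p, 2)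
      ?_ ?_ ?_ ?_
    · refine .of_forall fun n => Measurable.aestronglyMeasurable ?_
      have h1 := continuous_scaledBessel.measurable
      have h2 := fun i => (continuous_circleTheta (α i * a n)).measurable
      fun_prop
    · have hT2 : ∀ᶠ n : ℕ in atTop, ∀ i, circleTheta (α i * a n) (2 * n ^ 2) ≤ 2 :=
        eventually_all.mpr fun i => (hT i).eventually_le_const one_lt_two
      filter_upwards [hT2, eventually_gt_atTop 0] with n hn hn0
      refine (ae_restrict_iff' measurableSet_Ioi).mpr (.of_forall fun t ht => ?_)
      have ht0 : 0 < t := one_pos.trans ht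
      have hθ : ∀ i, 0 ≤ circleTheta (α i * a n) (2 * n ^ 2 * t) := fun i =>
        zero_le_one.trans (one_le_circleTheta (hM i n) _)
      have hG := scaledBessel_nonneg (2 * n ^ 2 * t)
      have hGC := hC (2 * n ^ 2 * t) (by positivity)
      rw [Real.norm_of_nonneg (mul_nonneg (by positivity) (Finset.prod_nonneg fun i _ => hθ i)),
        ← div_sqrt_two_mul_pow_div C ht0]
      have hCpos := hG.trans hGC
      refine mul_le_mul (by gcongr) (Finset.prod_le_prod (fun i _ => hθ i) fun i _ =>
        (circleTheta_antitone _ (hmono n t ht)).trans (hn i))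
        (Finset.prod_nonneg fun i _ => hθ i) (by positivity)
    · exact (((integrableOn_Ioi_rpow_of_lt (by linarith) one_pos).const_mul _).const_mul _).mul_const _
    · refine (ae_restrict_iff' measurableSet_Ioi).mpr (.of_forall fun t ht => ?_)
      have ht0 : 0 < t := one_pos.trans ht
      have hu : Tendsto (fun n : ℕ => 2 * (n : ℝ) ^ 2 * t) atTop atTop :=
        (((tendsto_pow_atTop two_ne_zero).comp tendsto_natCast_atTop_atTop).const_mul_atTop
          two_pos).atTop_mul_const ht0
      refine Tendsto.mul (((((tendsto_scaledBessel.comp hu).div_const _).pow _).div_const _).const_mul _)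
        (tendsto_finsetProd _ fun i _ => ?_)
      exact tendsto_of_tendsto_of_tendsto_of_le_of_le tendsto_const_nhds (hT i)
        (fun n => one_le_circleTheta (hM i n) _)
        (fun n => circleTheta_antitone _ (hmono n t ht))
  have hlim : ∫ t in Set.Ioi (1 : ℝ), b * ((1 / √(2 * π) / √(2 * t)) ^ (k + 1) / t) *
      ∏ _i : Fin p, (1 : ℝ) = 2 / (((p + k + 1 : ℕ) : ℝ) - p) * b *
        (4 * π) ^ (-((k + 1 : ℕ) : ℝ) / 2) := by
    have h4 : √(4 * π) = √(2 * π) * √2 := by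
      rw [← Real.sqrt_mul (by positivity)]
      congr 1
      ring
    have hpt : ∀ t ∈ Set.Ioi (1 : ℝ), b * ((1 / √(2 * π) / √(2 * t)) ^ (k + 1) / t) *
        ∏ _i : Fin p, (1 : ℝ) = b * (4 * π) ^ (-((k + 1 : ℕ) : ℝ) / 2) *
          t ^ (-((k + 1 : ℕ) : ℝ) / 2 - 1) := by
      intro t ht
      rw [Finset.prod_const_one, mul_one, div_sqrt_two_mul_pow_div _ (one_pos.trans ht), div_div,
        ← h4, one_div_sqrt_pow (by positivity), mul_assoc]
    rw [setIntegral_congr_fun measurableSet_Ioi hpt, integral_const_mul,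
      integral_Ioi_one_rpow k.succ_pos]
    push_cast
    ring
  rw [hlim] at key
  refine key.congr' ?_
  filter_upwards [eventually_gt_atTop 0] with n hn
  refine setIntegral_congr_fun measurableSet_Ioi fun t ht => ?_
  have := bessel_integrand_eq (k := k + 1) hα (ha n) b (Nat.cast_pos.mpr hn) (one_pos.trans ht)
  rw [← this, show ((p + k + 1 : ℕ) : ℝ) = ((k + 1 : ℕ) : ℝ) + p by push_cast; ring]
end
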